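/- Assume p = 0, χ₀ = λ ∈ (1/2)ℤ with λ < 1/2, and χ_j = 0 for all j < 0, so that G(m) = (λ − m − 1/2)Φ(m) for all m ∈ (1/2)ℤ. Then the kernel of the operator Φ(1/2 − λ) on F is a nonzero proper G-invariant subspace (so F(λ/z) is reducible); it equals the span of the exterior monomials in the generators e_r with r ≠ 1/2 − λ, and it has no G-invariant subspaces other than {0} and itself (i.e., it is an irreducible submodule). -/

import Mathlib

/-!
Common setup (following Adamović–Jing–Misra, "On principal realization of modules for
the affine Lie algebra A₁⁽¹⁾ at the critical level").

Half-integers `(1/2)ℤ` are encoded by doubling: an integer `n : ℤ` stands for the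
half-integer `n/2`.
-/

noncomputable section

/-- Positive half-integers (doubled encoding): `n : ℤ` with `0 < n` stands for `n/2`. -/
abbrev HalfPos : Type := {n : ℤ // 0 < n}

/-- The fermionic space `F = ⋀ V`, where `V` has basis `{e_r : r ∈ (1/2)ℤ, r > 0}`;
`F` is presented through its monomial basis, indexed by finite sets of positive
half-integers. -/
abbrev FSpace : Type := Finset HalfPos →₀ ℂ

/-- The basis monomial `e_{r₁} ∧ ⋯ ∧ e_{r_k}` (`r₁ < ⋯ < r_k` being the elements of `s`). -/
def bVec (s : Finset HalfPos) : FSpace := Finsupp.single s 1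

/-- The vacuum vector `𝟙`. -/
def vacuum : FSpace := bVec ∅

/-- The vector `e_r`. -/
def eVec (r : HalfPos) : FSpace := bVec {r}

/-- `Φ(-r)` for `r > 0`: left exterior multiplication by `e_r`. -/
def phiCreate (r : HalfPos) : FSpace →ₗ[ℂ] FSpace :=
  Finsupp.linearCombination ℂ fun s : Finset HalfPos =>
    if r ∈ s then 0
    else ((-1 : ℂ) ^ (s.filter fun t => t < r).card) • bVec (insert r s)

/-- `Φ(r)` for `r > 0`: the odd derivation of `⋀ V` with `Φ(r) e_s = -(-1)^{2r} δ_{r,s} 𝟙`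
(`(-1)^{2r} = (-1)^m` for the doubled index `m = 2r`). -/
def phiAnnih (r : HalfPos) : FSpace →ₗ[ℂ] FSpace :=
  Finsupp.linearCombination ℂ fun s : Finset HalfPos =>
    if r ∈ s then
      ((-(-1 : ℂ) ^ r.1) * (-1 : ℂ) ^ (s.filter fun t => t < r).card) • bVec (s.erase r)
    else 0

/-- `Φ(m)`, `m ∈ (1/2)ℤ` (doubled index `m : ℤ`); `Φ(0) = ε c · Id`. -/
def Phi (ε c : ℂ) (m : ℤ) : FSpace →ₗ[ℂ] FSpace :=
  if h : 0 < m then phiAnnih ⟨m, h⟩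
  else if h' : m < 0 then phiCreate ⟨-m, by omega⟩
  else (ε * c) • LinearMap.id

/-- `G(m) = (-m - 1/2) Φ(m) + Σ_{j ≤ p} χ_j Φ(m-j)` (a locally finite sum): on a basis
monomial `bVec s` only the finitely many indices `j` belonging to
`Finset.Icc m p ∪ (s.image fun t => m - t.1).filter (· ≤ p)` contribute (for any other
`j ≤ p` one has `Φ(m-j) (bVec s) = 0`), and the operator is defined by its values on
this basis.  (All indices are doubled: `m` stands for `m/2`, and `χ j` for `χ_{j/2}`.) -/
def Gop (ε c : ℂ) (p : ℤ) (χ : ℤ → ℂ) (m : ℤ) : FSpace →ₗ[ℂ] FSpace :=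
  Finsupp.linearCombination ℂ fun s : Finset HalfPos =>
    (-((m : ℂ) + 1) / 2) • Phi ε c m (bVec s) +
      ∑ j ∈ Finset.Icc m p ∪ (s.image fun t => m - t.1).filter (· ≤ p),
        χ j • Phi ε c (m - j) (bVec s)

/-- A subspace `W ⊆ F` is `G`-invariant if `G(m) W ⊆ W` for all `m ∈ (1/2)ℤ`. -/
def GInvariant (ε c : ℂ) (p : ℤ) (χ : ℤ → ℂ) (W : Submodule ℂ FSpace) : Prop :=
  ∀ m : ℤ, ∀ v ∈ W, Gop ε c p χ m v ∈ W

/-- `F(χ)` is irreducible: its only `G`-invariant subspaces are `{0}` and `F`. -/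
def FIrreducible (ε c : ℂ) (p : ℤ) (χ : ℤ → ℂ) : Prop :=
  ∀ W : Submodule ℂ FSpace, GInvariant ε c p χ W → W = ⊥ ∨ W = ⊤

theorem phiAnnih_apply (r : HalfPos) (v : FSpace) (t : Finset HalfPos) :
    phiAnnih r v t = if r ∈ t then 0 else
      (-(-1 : ℂ) ^ r.1) * (-1 : ℂ) ^ (t.filter fun u => u < r).card * v (insert r t) := by
  induction v using Finsupp.induction_linear with
  | zero => simp
  | add f g hf hg => rw [map_add, Finsupp.add_apply, hf, hg]; split_ifs <;> simp [mul_add]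
  | single s x =>
    rw [phiAnnih, Finsupp.linearCombination_single]
    by_cases hrs : r ∈ s
    · by_cases hrt : r ∈ t
      · have h : s.erase r ≠ t := fun h => Finset.notMem_erase r s (h ▸ hrt)
        simp [hrs, hrt, bVec, h]
      · by_cases h : s.erase r = t
        · subst h
          have hf : ((s.erase r).filter fun u => u < r) = s.filter fun u => u < r := by
            ext u
            simp only [Finset.mem_filter, Finset.mem_erase]
            exact ⟨fun h => ⟨h.1.2, h.2⟩, fun h => ⟨⟨h.2.ne, h.1⟩, h.2⟩⟩
          simp [hrs, bVec, hf, Finset.insert_erase hrs, mul_comm]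
        · have h' : s ≠ insert r t := by
            rintro rfl
            exact h (Finset.erase_insert hrt)
          simp [hrs, hrt, bVec, h, h']
    · have h : s ≠ insert r t := by
        rintro rfl
        exact hrs (Finset.mem_insert_self r t)
      simp [hrs, h]

theorem phiCreate_apply_of_erase_eq_zero (r : HalfPos) (v : FSpace) (t : Finset HalfPos)
    (hv : v (t.erase r) = 0) : phiCreate r v t = 0 := by
  rw [phiCreate, Finsupp.linearCombination_apply, Finsupp.sum, Finsupp.finsetSum_apply]
  refine Finset.sum_eq_zero fun s hs => ?_
  by_cases hrs : r ∈ s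
  · simp [hrs]
  · have h : insert r s ≠ t := by
      rintro rfl
      rw [Finset.erase_insert hrs] at hv
      exact Finsupp.mem_support_iff.mp hs hv
    simp [hrs, bVec, h]

theorem phiAnnih_apply_ne_zero {r : HalfPos} {v : FSpace} {s : Finset HalfPos}
    (hr : r ∈ s) (hv : v s ≠ 0) : phiAnnih r v (s.erase r) ≠ 0 := by
  rw [phiAnnih_apply, if_neg (Finset.notMem_erase r s), Finset.insert_erase hr]
  exact mul_ne_zero (mul_ne_zero (neg_ne_zero.mpr (zpow_ne_zero _ (by norm_num)))
    (pow_ne_zero _ (by norm_num))) hv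

theorem Phi_of_pos (ε c : ℂ) (r : HalfPos) : Phi ε c r.1 = phiAnnih r := by
  rw [Phi, dif_pos r.2]

theorem Phi_neg (ε c : ℂ) (r : HalfPos) : Phi ε c (-r.1) = phiCreate r := by
  have := r.2
  rw [Phi, dif_neg (by omega), dif_pos (by omega)]
  congr 1
  ext
  simp

theorem Phi_zero (ε c : ℂ) : Phi ε c 0 = (ε * c) • LinearMap.id := by
  simp [Phi]

theorem mem_ker_phiAnnih {r : HalfPos} {v : FSpace} :
    v ∈ LinearMap.ker (phiAnnih r) ↔ ∀ s, r ∈ s → v s = 0 := by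
  rw [LinearMap.mem_ker]
  constructor
  · intro h s hs
    by_contra hv
    exact phiAnnih_apply_ne_zero hs hv (by simp [h])
  · intro h
    ext t
    rw [phiAnnih_apply, h _ (Finset.mem_insert_self r t)]
    simp

theorem ker_phiAnnih_eq_span (r : HalfPos) :
    LinearMap.ker (phiAnnih r) =
      Submodule.span ℂ {v : FSpace | ∃ s : Finset HalfPos, r ∉ s ∧ v = bVec s} := by
  have h : {v : FSpace | ∃ s : Finset HalfPos, r ∉ s ∧ v = bVec s} =
      (fun s => Finsupp.single s (1 : ℂ)) '' {s : Finset HalfPos | r ∉ s} := by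
    ext v
    simp [bVec, eq_comm]
  rw [h, ← Finsupp.supported_eq_span_single]
  ext v
  rw [mem_ker_phiAnnih, Finsupp.mem_supported']
  simp

/-- When `χ` is concentrated in degree `0`, `G(m)` is a scalar multiple of `Φ(m)`. -/
theorem Gop_eq_smul_Phi (ε c : ℂ) (χ : ℤ → ℂ) (hχ : ∀ j : ℤ, j < 0 → χ j = 0) (m : ℤ) :
    Gop ε c 0 χ m = (-((m : ℂ) + 1) / 2 + χ 0) • Phi ε c m := by
  refine Finsupp.lhom_ext' fun s => LinearMap.ext_ring ?_
  simp only [LinearMap.comp_apply, Finsupp.lsingle_apply, LinearMap.smul_apply]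
  rw [Gop, Finsupp.linearCombination_single, one_smul, add_smul]
  change _ = _ + χ 0 • Phi ε c m (bVec s)
  congr 1
  rw [Finset.sum_eq_single 0]
  · simp
  · intro j hj hj0
    have : j ≤ 0 := by
      rcases Finset.mem_union.mp hj with h | h
      · exact (Finset.mem_Icc.mp h).2
      · exact (Finset.mem_filter.mp h).2
    rw [hχ j (by omega), zero_smul]
  · intro h0
    simp only [Finset.mem_union, Finset.mem_Icc, Finset.mem_filter, Finset.mem_image,
      le_refl, and_true, not_or, not_le] at h0
    have hs : (⟨m, h0.1⟩ : HalfPos) ∉ s := fun hs => h0.2 ⟨_, hs, sub_self m⟩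
    rw [sub_zero, Phi, dif_pos h0.1, phiAnnih, bVec, Finsupp.linearCombination_single,
      if_neg hs, smul_zero, smul_zero]

theorem vacuum_mem_of_phiAnnih_mem {W : Submodule ℂ FSpace}
    (hW : ∀ r, ∀ v ∈ W, phiAnnih r v ∈ W) (n : ℕ) :
    ∀ v ∈ W, v ≠ 0 → (∀ s, v s ≠ 0 → s.card ≤ n) → vacuum ∈ W := by
  induction n with
  | zero =>
    intro v hv hv0 hn
    have hsupp : ∀ s, s ≠ ∅ → v s = 0 := fun s hs => by
      by_contra h
      exact hs (Finset.card_eq_zero.mp (Nat.le_zero.mp (hn s h)))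
    have hv' : v = v ∅ • vacuum := by
      ext s
      by_cases hs : s = ∅
      · simp [hs, vacuum, bVec]
      · simp [hsupp s hs, vacuum, bVec, Ne.symm hs]
    have h0 : v ∅ ≠ 0 := fun h => hv0 (by rw [hv', h, zero_smul])
    exact (W.smul_mem_iff h0).mp (hv' ▸ hv)
  | succ n ih =>
    intro v hv hv0 hn
    by_cases hs : ∃ s, v s ≠ 0 ∧ s.Nonempty
    · obtain ⟨s, hvs, r, hr⟩ := hs
      refine ih _ (hW r v hv) (fun h => phiAnnih_apply_ne_zero hr hvs (by simp [h])) ?_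
      intro t ht
      rw [phiAnnih_apply] at ht
      by_cases hrt : r ∈ t
      · simp [hrt] at ht
      · rw [if_neg hrt] at ht
        have := hn _ (right_ne_zero_of_mul ht)
        rw [Finset.card_insert_of_notMem hrt] at this
        omega
    · push Not at hs
      exact ih v hv hv0 fun s h => by simp [hs s h]

theorem bVec_mem_of_phiCreate_mem {a : HalfPos} {W : Submodule ℂ FSpace}
    (hW : ∀ r ≠ a, ∀ v ∈ W, phiCreate r v ∈ W) (h0 : vacuum ∈ W) (s : Finset HalfPos)
    (hs : a ∉ s) : bVec s ∈ W := by
  induction s using Finset.induction_on with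
  | empty => exact h0
  | insert r s hr ih =>
    rw [Finset.mem_insert, not_or] at hs
    have h := hW r (Ne.symm hs.1) _ (ih hs.2)
    rw [phiCreate, bVec, Finsupp.linearCombination_single, if_neg hr, one_smul] at h
    exact (W.smul_mem_iff (pow_ne_zero _ (by norm_num))).mp h

/-- Example 4.1(2) of the paper.  For `p = 0`, `χ₀ = λ ∈ ½ℤ`,
`λ < ½` (doubled `lam < 1`) and `χ_j = 0` for `j < 0` (so `G(m) = (λ-m-½)Φ(m)`):
`Ker Φ(½-λ)` is a nonzero proper `G`-invariant subspace of `F`, it is spanned by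
the monomials avoiding `e_{½-λ}`, and it is an irreducible submodule. -/
theorem ker_Phi_irreducible_submodule
    (ε c : ℂ) (hε : ε = 1 ∨ ε = -1) (hc : c ^ 2 = -(1 / 2))
    (lam : ℤ) (hlam : lam < 1) (χ : ℤ → ℂ)
    (hχ0 : χ 0 = (lam : ℂ) / 2) (hχ : ∀ j : ℤ, j < 0 → χ j = 0) :
    LinearMap.ker (Phi ε c (1 - lam)) ≠ ⊥ ∧
    LinearMap.ker (Phi ε c (1 - lam)) ≠ ⊤ ∧
    GInvariant ε c 0 χ (LinearMap.ker (Phi ε c (1 - lam))) ∧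
    LinearMap.ker (Phi ε c (1 - lam)) =
      Submodule.span ℂ {v : FSpace | ∃ s : Finset HalfPos,
        (⟨1 - lam, by omega⟩ : HalfPos) ∉ s ∧ v = bVec s} ∧
    (∀ W ≤ LinearMap.ker (Phi ε c (1 - lam)), GInvariant ε c 0 χ W →
      W = ⊥ ∨ W = LinearMap.ker (Phi ε c (1 - lam))) := by
  set a : HalfPos := ⟨1 - lam, by omega⟩ with ha
  have hker : Phi ε c (1 - lam) = phiAnnih a := Phi_of_pos ε c a
  have hG : ∀ m : ℤ, Gop ε c 0 χ m = (((lam - m - 1 : ℤ) : ℂ) / 2) • Phi ε c m := by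
    intro m
    rw [Gop_eq_smul_Phi ε c χ hχ, hχ0]
    congr 1
    push_cast
    ring
  rw [hker]
  refine ⟨?_, ?_, ?_, ker_phiAnnih_eq_span a, ?_⟩
  · refine (Submodule.ne_bot_iff _).mpr ⟨vacuum, mem_ker_phiAnnih.mpr fun s hs => ?_, ?_⟩
    · have : ∅ ≠ s := (Finset.ne_empty_of_mem hs).symm
      simp [vacuum, bVec, this]
    · simp [vacuum, bVec]
  · intro h
    have : eVec a ∈ LinearMap.ker (phiAnnih a) := h ▸ Submodule.mem_top
    simpa [eVec, bVec] using mem_ker_phiAnnih.mp this {a} (Finset.mem_singleton_self a)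
  · intro m v hv
    rw [hG]
    by_cases hm : m = lam - 1
    · simp [hm]
    refine Submodule.smul_mem _ _ ?_
    rw [mem_ker_phiAnnih] at hv ⊢
    intro s hs
    rcases lt_trichotomy m 0 with h | rfl | h
    · obtain ⟨r, rfl⟩ : ∃ r : HalfPos, m = -r.1 := ⟨⟨-m, by omega⟩, by simp⟩
      rw [Phi_neg]
      refine phiCreate_apply_of_erase_eq_zero r v s (hv _ (Finset.mem_erase.mpr ⟨?_, hs⟩))
      intro har
      refine hm ?_
      rw [← har]
      simp [a]
    · simp [Phi_zero, hv s hs]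
    · rw [Phi_of_pos ε c ⟨m, h⟩, phiAnnih_apply, hv _ (Finset.mem_insert_of_mem hs)]
      simp
  · intro W hWker hW
    have hPhi : ∀ m ≠ lam - 1, ∀ v ∈ W, Phi ε c m v ∈ W := by
      intro m hm v hv
      have h := hW m v hv
      rw [hG, LinearMap.smul_apply] at h
      refine (W.smul_mem_iff (div_ne_zero (Int.cast_ne_zero.mpr ?_) two_ne_zero)).mp h
      omega
    refine or_iff_not_imp_left.mpr fun hne => le_antisymm hWker ?_
    obtain ⟨v, hv, hv0⟩ := (Submodule.ne_bot_iff W).mp hne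
    have hvac : vacuum ∈ W := by
      refine vacuum_mem_of_phiAnnih_mem (fun r w hw => ?_) (v.support.sup Finset.card) v hv hv0
        fun s hs => Finset.le_sup (f := Finset.card) (Finsupp.mem_support_iff.mpr hs)
      rw [← Phi_of_pos ε c r]
      exact hPhi _ (by have := r.2; omega) w hw
    rw [ker_phiAnnih_eq_span, Submodule.span_le]
    rintro _ ⟨s, hs, rfl⟩
    refine bVec_mem_of_phiCreate_mem (fun r hr w hw => ?_) hvac s hs
    rw [← Phi_neg ε c r]
    refine hPhi _ (fun h => hr (Subtype.ext ?_)) w hw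
    simp only [ha]
    omega
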